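/- For every r_f > 0 and M > 0 there exists a constant C > 0 such that for every closed disk B_M ⊆ ℝ² of radius M and all b₋, b₊, b₋', b₊', d₋, d₊ ∈ [0, r_f] with d₋ < d₊ and with either (b₋ < b₊ = b₋' < b₊') or (b₋ = b₋' < b₊ = b₊'), the four-fold integral ∫_{B_M⁴} 1{b₋ < |x₁ − x₂|/2 ≤ b₊} · 1{b₋' < |x₁ − x₃|/2 ≤ b₊'} · 1{0 < |x₂ − x₃|/2 ≤ b₊ ∨ b₊'} · 1{y₁ ∈ D_{d₋,d₊}(x₂,x₃)} dy₁ dx₁ dx₂ dx₃ is at most C · |B_M| · (δ_b ∧ δ_{b'}) · (δ_b ∨ δ_{b'})^{3/4} · δ_d^{3/4}, where δ_b = b₊ − b₋, δ_{b'} = b₊' − b₋', δ_d = d₊ − d₋. -/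

import Mathlib

open MeasureTheory Real
open scoped Classical

noncomputable section

/-- The Euclidean plane. -/
abbrev E2 : Type := EuclideanSpace ℝ (Fin 2)

/-- Rotation of a planar vector by `π/2`; it is orthogonal to `v` and has the same norm. -/
def perp (v : E2) : E2 := (WithLp.equiv 2 (Fin 2 → ℝ)).symm ![-(v 1), v 0]

/-- For `d ≥ a := |x − y|/2`, the closed disk of radius `d` whose boundary circle passes
through `x` and `y`, with center `midpoint x y + sgn·√(d² − a²)·n`, where `n` is the unit
vector orthogonal to `y − x` obtained by normalizing `perp (y - x)`; for `d < a` it is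
empty.  `sgn = 1` gives `B_d^+(x,y)` and `sgn = -1` gives `B_d^-(x,y)`. -/
def diskPM (x y : E2) (d : ℝ) (sgn : ℝ) : Set E2 :=
  if d < ‖y - x‖ / 2 then ∅
  else Metric.closedBall
    (midpoint ℝ x y + ((sgn * Real.sqrt (d ^ 2 - (‖y - x‖ / 2) ^ 2)) / ‖y - x‖) • perp (y - x)) d

/-- The set `D_{d₋,d₊}(x,y)` of points `z` such that the boundaries of the three equal disks
around `x`, `y`, `z` meet at a time `r` with `d₋ < r ≤ d₊`; empty when `x = y`. -/
def Dset (x y : E2) (dm dp : ℝ) : Set E2 :=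
  if x = y then ∅
  else
    (diskPM x y dp 1 ∪ diskPM x y dp (-1)) \
      (diskPM x y (max dm (‖y - x‖ / 2)) 1 ∪ diskPM x y (max dm (‖y - x‖ / 2)) (-1))

end


lemma vol_closedBall (x : E2) (r : ℝ) (hr : 0 ≤ r) :
    volume.real (Metric.closedBall x r) = r ^ 2 * π := by
  rw [Measure.real, EuclideanSpace.volume_closedBall_fin_two, ENNReal.toReal_mul,
    ENNReal.toReal_pow, ENNReal.toReal_ofReal hr, ENNReal.toReal_ofReal Real.pi_pos.le]

lemma vol_annulus (x : E2) (r R : ℝ) (hr : 0 ≤ r) (h : r ≤ R) :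
    volume.real (Metric.closedBall x R \ Metric.closedBall x r) = (R ^ 2 - r ^ 2) * π := by
  rw [measureReal_sdiff (Metric.closedBall_subset_closedBall h) measurableSet_closedBall
    (measure_closedBall_lt_top.ne), vol_closedBall x r hr, vol_closedBall x R (hr.trans h)]
  ring

lemma perp_norm (v : E2) : ‖perp v‖ = ‖v‖ := by
  simp only [perp, EuclideanSpace.norm_eq, Fin.sum_univ_two]
  simp [add_comm]

noncomputable def Wf (d δ t : ℝ) : ℝ := if t < 2 * d then 1 / (d ^ 2 - t ^ 2 / 4 + δ) ^ 2 else 0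

lemma Wf_nonneg (d δ t : ℝ) : 0 ≤ Wf d δ t := by
  unfold Wf; split_ifs <;> positivity

lemma Wf_meas (d δ : ℝ) : Measurable (Wf d δ) := by
  unfold Wf
  exact Measurable.ite measurableSet_Iio (by fun_prop) measurable_const

lemma Wf_pos_aux {d δ y : ℝ} (hδ : 0 < δ) (h0 : 0 ≤ y) (hy : y ≤ 2 * d) :
    δ ≤ d ^ 2 - y ^ 2 / 4 + δ := by nlinarith

lemma Wf_integrable (d δ : ℝ) (hδ : 0 < δ) :
    Integrable (fun z : E2 => Wf d δ ‖z‖) volume := by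
  have h1 : Integrable ((Metric.ball (0:E2) (2*d)).indicator (fun _ => 1 / δ ^ 2)) volume := by
    rw [integrable_indicator_iff measurableSet_ball]
    exact integrableOn_const (measure_ball_lt_top.ne)
  refine h1.mono' ((Wf_meas d δ).comp measurable_norm).aestronglyMeasurable (ae_of_all _ ?_)
  intro z
  rw [Real.norm_of_nonneg (Wf_nonneg _ _ _)]
  unfold Wf
  by_cases h : ‖z‖ < 2 * d
  · have := Wf_pos_aux hδ (norm_nonneg z) h.le
    rw [if_pos h, Set.indicator_of_mem (by simpa using h)]
    gcongr
  · rw [if_neg h, Set.indicator_of_notMem (by simpa using h)]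

lemma Wf_integral (d δ : ℝ) (hd : 0 < d) (hδ : 0 < δ) :
    ∫ z : E2, Wf d δ ‖z‖ ≤ 4 * π / δ := by
  rw [integral_fun_norm_addHaar]
  have hb : volume.real (Metric.ball (0:E2) 1) = π := by
    rw [Measure.real, EuclideanSpace.volume_ball_fin_two]; simp [Real.pi_pos.le]
  have h1 : ∫ y in Set.Ioi (0:ℝ), y ^ (Module.finrank ℝ E2 - 1) • Wf d δ y
      = ∫ y in (0:ℝ)..(2*d), y / (d ^ 2 - y ^ 2 / 4 + δ) ^ 2 := by
    rw [intervalIntegral.integral_of_le (by positivity), integral_Ioc_eq_integral_Ioo,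
      ← integral_indicator measurableSet_Ioi, ← integral_indicator measurableSet_Ioo]
    congr 1
    ext y
    by_cases h0 : 0 < y
    · by_cases h2 : y < 2 * d
      · rw [Set.indicator_of_mem (by simpa using h0), Set.indicator_of_mem (show y ∈ Set.Ioo 0 (2*d) from ⟨h0, h2⟩)]
        simp [Wf, h2, div_eq_mul_inv]
      · rw [Set.indicator_of_mem (by simpa using h0), Set.indicator_of_notMem (by simp [h2])]
        simp [Wf, h2]
    · rw [Set.indicator_of_notMem (by simpa using h0), Set.indicator_of_notMem (by simp [h0])]
  have h2 : ∫ y in (0:ℝ)..(2*d), y / (d ^ 2 - y ^ 2 / 4 + δ) ^ 2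
      = 2 / (d ^ 2 - (2*d) ^ 2 / 4 + δ) - 2 / (d ^ 2 - 0 ^ 2 / 4 + δ) := by
    have hne : ∀ y ∈ Set.uIcc 0 (2*d), d ^ 2 - y ^ 2 / 4 + δ ≠ 0 := by
      intro y hy
      rw [Set.uIcc_of_le (by positivity)] at hy
      have := Wf_pos_aux hδ hy.1 hy.2
      linarith
    refine intervalIntegral.integral_eq_sub_of_hasDerivAt
      (f := fun y => 2 / (d ^ 2 - y ^ 2 / 4 + δ)) ?_ ?_
    · intro y hy
      have hn := hne y hy
      have h0 : HasDerivAt (fun x : ℝ => d ^ 2 - x ^ 2 / 4 + δ) (-(2 * y / 4)) y := by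
        have := (((hasDerivAt_pow 2 y).div_const 4).const_sub (d^2)).add_const δ
        simpa using this
      have h := (hasDerivAt_const y (2:ℝ)).fun_div h0 hn
      have e : (0 * (d ^ 2 - y ^ 2 / 4 + δ) - 2 * -(2 * y / 4)) / (d ^ 2 - y ^ 2 / 4 + δ) ^ 2 =
          y / (d ^ 2 - y ^ 2 / 4 + δ) ^ 2 := by ring
      rw [e] at h
      exact h
    · apply ContinuousOn.intervalIntegrable
      apply ContinuousOn.div (by fun_prop) (by fun_prop)
      intro y hy
      exact pow_ne_zero _ (hne y hy)
  rw [h1, h2, hb]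
  have h3 : 0 ≤ 2 / (d ^ 2 - 0 ^ 2 / 4 + δ) := by
    have := Wf_pos_aux (y := 0) hδ le_rfl (by positivity : (0:ℝ) ≤ 2 * d)
    exact div_nonneg (by norm_num) (by linarith)
  have h4 : d ^ 2 - (2*d) ^ 2 / 4 + δ = δ := by ring
  rw [h4]
  simp only [finrank_euclideanSpace, Fintype.card_fin, nsmul_eq_mul, smul_eq_mul]
  push_cast
  have : 2 * (π * (2 / δ - 2 / (d ^ 2 - 0 ^ 2 / 4 + δ))) ≤ 2 * (π * (2 / δ)) := by
    have := Real.pi_pos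
    gcongr
    linarith
  refine this.trans (le_of_eq ?_)
  ring

lemma diskPM_meas (x y : E2) (d s : ℝ) : MeasurableSet (diskPM x y d s) := by
  unfold diskPM; split_ifs
  · exact MeasurableSet.empty
  · exact measurableSet_closedBall

lemma Dset_meas (x y : E2) (dm dp : ℝ) : MeasurableSet (Dset x y dm dp) := by
  unfold Dset; split_ifs
  · exact MeasurableSet.empty
  · exact ((diskPM_meas _ _ _ _).union (diskPM_meas _ _ _ _)).diff
      ((diskPM_meas _ _ _ _).union (diskPM_meas _ _ _ _))

/-- one-sided difference -/
lemma diskPM_diff_vol (x y : E2) (hxy : x ≠ y) (d e s rf : ℝ) (hs : |s| = 1)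
    (hae : ‖y - x‖ / 2 ≤ e) (hed : e ≤ d) (hd : d ≤ rf) :
    volume.real (diskPM x y d s \ diskPM x y e s) ≤
      8 * π * rf * (√(d ^ 2 - (‖y - x‖ / 2) ^ 2) - √(e ^ 2 - (‖y - x‖ / 2) ^ 2)) := by
  have hn : 0 < ‖y - x‖ := norm_pos_iff.2 (sub_ne_zero.2 hxy.symm)
  unfold diskPM
  rw [if_neg (by linarith), if_neg (by linarith)]
  set a := ‖y - x‖ / 2 with ha
  have ha0 : 0 < a := by positivity
  set hp := √(d ^ 2 - a ^ 2) with hhp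
  set hm := √(e ^ 2 - a ^ 2) with hhm
  have hp2 : hp ^ 2 = d ^ 2 - a ^ 2 := Real.sq_sqrt (by nlinarith)
  have hm2 : hm ^ 2 = e ^ 2 - a ^ 2 := Real.sq_sqrt (by nlinarith)
  have hm0 : 0 ≤ hm := Real.sqrt_nonneg _
  have hle : hm ≤ hp := Real.sqrt_le_sqrt (by nlinarith)
  have hde : d - e ≤ hp - hm := by
    by_contra hc
    push Not at hc
    have h1 : hm ≤ e := by nlinarith
    have h2 : hp ≤ d := by nlinarith
    have h3 : (d - e) * (d + e) = (hp - hm) * (hp + hm) := by nlinarith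
    have h4 : (hp - hm) * (hp + hm) ≤ (hp - hm) * (d + e) := by
      apply mul_le_mul_of_nonneg_left <;> linarith
    have h5 : (hp - hm) * (d + e) < (d - e) * (d + e) := by
      apply mul_lt_mul_of_pos_right hc; linarith
    linarith
  have hpd : hp ≤ d := by nlinarith
  set c1 := midpoint ℝ x y + ((s * hp) / ‖y - x‖) • perp (y - x) with hc1
  set c2 := midpoint ℝ x y + ((s * hm) / ‖y - x‖) • perp (y - x) with hc2
  have hdist : dist c1 c2 = hp - hm := by
    rw [hc1, hc2, dist_add_left, dist_eq_norm, ← sub_smul, norm_smul, perp_norm, ← sub_div,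
      ← mul_sub, norm_div, norm_mul, norm_norm, div_mul_cancel₀ _ hn.ne', Real.norm_eq_abs, hs,
      one_mul, Real.norm_of_nonneg (by linarith)]
  have hsub : Metric.closedBall c1 d \ Metric.closedBall c2 e ⊆
      Metric.closedBall c2 (e + 2 * (hp - hm)) \ Metric.closedBall c2 e := by
    apply Set.sdiff_subset_sdiff_left
    apply Metric.closedBall_subset_closedBall'
    rw [hdist]; linarith
  calc _ ≤ volume.real (Metric.closedBall c2 (e + 2 * (hp - hm)) \ Metric.closedBall c2 e) :=
        measureReal_mono hsub
          ((measure_mono Set.sdiff_subset).trans_lt measure_closedBall_lt_top).ne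
    _ = ((e + 2 * (hp - hm)) ^ 2 - e ^ 2) * π :=
        vol_annulus _ _ _ (by linarith) (by linarith)
    _ = 4 * ((hp - hm) * (e + (hp - hm))) * π := by ring
    _ ≤ 4 * ((hp - hm) * (rf + rf)) * π := by
        have := Real.pi_pos
        have : 0 ≤ hp - hm := by linarith
        gcongr <;> linarith
    _ = _ := by ring

set_option maxHeartbeats 2000000 in
lemma Dset_vol (x y : E2) (dm dp rf lam : ℝ) (hdm : 0 ≤ dm) (hlt : dm < dp) (hdp : dp ≤ rf)
    (hl : 0 < lam) :
    volume.real (Dset x y dm dp) ≤ lam +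
      ((16 * π * rf) ^ 4 * (4 * rf ^ 2 + 2 * rf) ^ 2 * (dp - dm) ^ 4 / lam ^ 3) *
        Wf dp (dp - dm) ‖x - y‖ := by
  have hW := Wf_nonneg dp (dp - dm) ‖x - y‖
  have hrf : 0 < rf := by linarith
  have hdel : 0 < dp - dm := by linarith
  have hK : 0 ≤ (16 * π * rf) ^ 4 * (4 * rf ^ 2 + 2 * rf) ^ 2 * (dp - dm) ^ 4 / lam ^ 3 := by
    positivity
  by_cases hxy : x = y
  · rw [Dset, if_pos hxy]; simp; positivity
  by_cases hage : dp ≤ ‖y - x‖ / 2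
  · have : Dset x y dm dp = ∅ := by
      rw [Dset, if_neg hxy, max_eq_right (by linarith)]
      rcases hage.lt_or_eq with h | h
      · simp [diskPM, h]
      · rw [← h]; simp
    rw [this]; simp; positivity
  push Not at hage
  rw [norm_sub_rev x y, Wf, if_pos (by linarith)]
  set e := max dm (‖y - x‖ / 2) with he
  have hae : ‖y - x‖ / 2 ≤ e := le_max_right _ _
  have hed : e ≤ dp := max_le hlt.le hage.le
  have hv1 := diskPM_diff_vol x y hxy dp e 1 rf (by simp) hae hed hdp
  have hv2 := diskPM_diff_vol x y hxy dp e (-1) rf (by simp) hae hed hdp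
  have hfin : ∀ s t : ℝ, volume (diskPM x y dp s \ diskPM x y e t) ≠ ⊤ := by
    intro s t
    refine ((measure_mono Set.sdiff_subset).trans_lt ?_).ne
    unfold diskPM; split_ifs
    · simp
    · exact measure_closedBall_lt_top
  have hsub : Dset x y dm dp ⊆ (diskPM x y dp 1 \ diskPM x y e 1) ∪
      (diskPM x y dp (-1) \ diskPM x y e (-1)) := by
    rw [Dset, if_neg hxy]
    rintro z ⟨h1 | h1, h2⟩
    · exact Or.inl ⟨h1, fun h => h2 (Or.inl h)⟩
    · exact Or.inr ⟨h1, fun h => h2 (Or.inr h)⟩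
  have hvol : volume.real (Dset x y dm dp) ≤ 
      16 * π * rf * (√(dp ^ 2 - (‖y - x‖ / 2) ^ 2) - √(e ^ 2 - (‖y - x‖ / 2) ^ 2)) := by
    have h3 := measureReal_mono (μ := volume) hsub (measure_union_ne_top (hfin _ _) (hfin _ _))
    have h4 := measureReal_union_le (μ := volume) (diskPM x y dp 1 \ diskPM x y e 1)
      (diskPM x y dp (-1) \ diskPM x y e (-1))
    linarith
  have hsq : dp ^ 2 - ‖y - x‖ ^ 2 / 4 = dp ^ 2 - (‖y - x‖ / 2) ^ 2 := by ring
  rw [hsq]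
  have ha0 : 0 ≤ ‖y - x‖ / 2 := by positivity
  set a := ‖y - x‖ / 2 with ha
  set hp := √(dp ^ 2 - a ^ 2) with hhp
  set hm := √(e ^ 2 - a ^ 2) with hhm
  have hp2 : hp ^ 2 = dp ^ 2 - a ^ 2 := Real.sq_sqrt (by nlinarith)
  have hm2 : hm ^ 2 = e ^ 2 - a ^ 2 := Real.sq_sqrt (by nlinarith)
  have hm0 : 0 ≤ hm := Real.sqrt_nonneg _
  have hle : hm ≤ hp := Real.sqrt_le_sqrt (by nlinarith)
  rw [← hp2]
  set η := hp - hm with hη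
  have hη0 : 0 ≤ η := by linarith
  set δ := dp - dm with hδ
  have hdm_e : dm ≤ e := le_max_left _ _
  have hmain : η * (hp + hm) ≤ 2 * rf * δ := by
    have : η * (hp + hm) = (dp - e) * (dp + e) := by rw [hη]; nlinarith
    rw [this]
    have : (dp - e) * (dp + e) ≤ δ * (2 * rf) := by
      apply mul_le_mul <;> linarith
    linarith
  have k1 : η * hp ≤ 2 * rf * δ := le_trans (by nlinarith) hmain
  have k2 : η ^ 2 ≤ 2 * rf * δ := le_trans (by nlinarith) hmain
  have k3 : η ^ 2 * (hp ^ 2 + δ) ≤ (4 * rf ^ 2 + 2 * rf) * δ ^ 2 := by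
    have q1 : (η * hp) ^ 2 ≤ (2 * rf * δ) ^ 2 :=
      pow_le_pow_left₀ (mul_nonneg hη0 (by linarith)) k1 2
    have q2 : η ^ 2 * δ ≤ 2 * rf * δ * δ := mul_le_mul_of_nonneg_right k2 hdel.le
    calc η ^ 2 * (hp ^ 2 + δ) = (η * hp) ^ 2 + η ^ 2 * δ := by ring
      _ ≤ (2 * rf * δ) ^ 2 + 2 * rf * δ * δ := add_le_add q1 q2
      _ = _ := by ring
  have hpos : 0 < hp ^ 2 + δ := by positivity
  have k4 : η ^ 4 ≤ (4 * rf ^ 2 + 2 * rf) ^ 2 * δ ^ 4 * (1 / (hp ^ 2 + δ) ^ 2) := by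
    rw [mul_one_div, le_div_iff₀ (by positivity)]
    calc η ^ 4 * (hp ^ 2 + δ) ^ 2 = (η ^ 2 * (hp ^ 2 + δ)) ^ 2 := by ring
      _ ≤ ((4 * rf ^ 2 + 2 * rf) * δ ^ 2) ^ 2 := pow_le_pow_left₀ (by positivity) k3 2
      _ = _ := by ring
  refine hvol.trans ?_
  set g := 16 * π * rf * η with hg
  have hg0 : 0 ≤ g := by positivity
  have k5 : g ≤ lam + g ^ 4 / lam ^ 3 := by
    rcases le_total g lam with h | h
    · have : 0 ≤ g ^ 4 / lam ^ 3 := by positivity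
      linarith
    · have : g ≤ g ^ 4 / lam ^ 3 := by
        rw [le_div_iff₀ (by positivity)]
        calc g * lam ^ 3 ≤ g * g ^ 3 := by gcongr
          _ = g ^ 4 := by ring
      linarith
  refine k5.trans ?_
  gcongr
  calc g ^ 4 / lam ^ 3 = (16 * π * rf) ^ 4 / lam ^ 3 * η ^ 4 := by rw [hg]; ring
    _ ≤ (16 * π * rf) ^ 4 / lam ^ 3 * 
      ((4 * rf ^ 2 + 2 * rf) ^ 2 * δ ^ 4 * (1 / (hp ^ 2 + δ) ^ 2)) := by gcongr
    _ = _ := by ring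

noncomputable def ann (b b' : ℝ) (u v : E2) : ℝ :=
  if ‖u - v‖ / 2 ∈ Set.Ioc b b' then (1 : ℝ) else 0

lemma ann_nonneg (b b' : ℝ) (u v : E2) : 0 ≤ ann b b' u v := by
  unfold ann; split_ifs <;> norm_num

lemma ann_le_one (b b' : ℝ) (u v : E2) : ann b b' u v ≤ 1 := by
  unfold ann; split_ifs <;> norm_num

lemma ann_symm (b b' : ℝ) (u v : E2) : ann b b' u v = ann b b' v u := by
  unfold ann; rw [norm_sub_rev]

lemma ann_meas (b b' : ℝ) : Measurable (fun p : E2 × E2 => ann b b' p.1 p.2) := by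
  unfold ann
  refine Measurable.ite ?_ measurable_const measurable_const
  exact measurableSet_Ioc.preimage (by fun_prop)

lemma ann_integral (b b' rf : ℝ) (v : E2) (S : Set E2) (hb : 0 ≤ b) (hbb : b ≤ b')
    (hb' : b' ≤ rf) :
    ∫ u in S, ann b b' u v ≤ 8 * π * rf * (b' - b) := by
  set A := Metric.closedBall v (2 * b') \ Metric.closedBall v (2 * b) with hA
  have hAm : MeasurableSet A := measurableSet_closedBall.diff measurableSet_closedBall
  have h1 : (fun u => ann b b' u v) = A.indicator (fun _ => (1:ℝ)) := by
    ext u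
    unfold ann
    have : ‖u - v‖ / 2 ∈ Set.Ioc b b' ↔ u ∈ A := by
      simp only [hA, Set.mem_Ioc, Set.mem_sdiff, Metric.mem_closedBall, dist_eq_norm, not_le]
      constructor <;> rintro ⟨h, h'⟩ <;> constructor <;> linarith
    by_cases h : u ∈ A
    · rw [if_pos (this.2 h), Set.indicator_of_mem h]
    · rw [if_neg (fun h' => h (this.1 h')), Set.indicator_of_notMem h]
  have hfin : volume A ≠ ⊤ :=
    ((measure_mono Set.sdiff_subset).trans_lt measure_closedBall_lt_top).ne
  have hint : Integrable (fun u => ann b b' u v) volume := by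
    rw [h1, integrable_indicator_iff hAm]
    exact integrableOn_const hfin
  calc ∫ u in S, ann b b' u v ≤ ∫ u, ann b b' u v :=
        setIntegral_le_integral hint (ae_of_all _ fun u => ann_nonneg _ _ _ _)
    _ = volume.real A := by
        rw [h1, integral_indicator hAm]; simp
    _ = ((2 * b') ^ 2 - (2 * b) ^ 2) * π := vol_annulus _ _ _ (by linarith) (by linarith)
    _ = 4 * ((b' - b) * (b' + b)) * π := by ring
    _ ≤ 4 * ((b' - b) * (rf + rf)) * π := by
        have := Real.pi_pos
        have : 0 ≤ b' - b := by linarith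
        gcongr; linarith
    _ = _ := by ring

lemma rpow_aux (m D : ℝ) (hm : 0 < m) (hD : 0 < D) :
    ∃ lam > 0, lam * m = m ^ ((3:ℝ)/4) * D ^ ((3:ℝ)/4) ∧
      D ^ 3 / lam ^ 3 = m ^ ((3:ℝ)/4) * D ^ ((3:ℝ)/4) := by
  refine ⟨D ^ ((3:ℝ)/4) * m ^ (-(1:ℝ)/4), by positivity, ?_, ?_⟩
  · have : m ^ ((3:ℝ)/4) = m ^ (-(1:ℝ)/4) * m := by
      conv_rhs => rw [← Real.rpow_one m, ← Real.rpow_mul hm.le, ← Real.rpow_add hm]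
      norm_num
    rw [this]; ring
  · rw [div_eq_iff (by positivity), mul_pow, ← Real.rpow_natCast, ← Real.rpow_natCast,
      ← Real.rpow_natCast, ← Real.rpow_mul hD.le, ← Real.rpow_mul hm.le]
    have : m ^ ((3:ℝ)/4) * D ^ ((3:ℝ)/4) * (D ^ ((3:ℝ) / 4 * (3:ℕ)) * m ^ (-(1:ℝ) / 4 * (3:ℕ)))
      = (m ^ ((3:ℝ)/4) * m ^ (-(1:ℝ) / 4 * (3:ℕ))) * (D ^ ((3:ℝ)/4) * D ^ ((3:ℝ) / 4 * (3:ℕ))) := by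
      ring
    rw [this, ← Real.rpow_add hm, ← Real.rpow_add hD]
    norm_num

lemma diskPM_fin (x y : E2) (d s : ℝ) : volume (diskPM x y d s) < ⊤ := by
  unfold diskPM; split_ifs
  · simp
  · exact measure_closedBall_lt_top

lemma Dset_fin (x y : E2) (dm dp : ℝ) : volume (Dset x y dm dp) ≠ ⊤ := by
  unfold Dset; split_ifs
  · simp
  · exact ((measure_mono Set.sdiff_subset).trans_lt
      (measure_union_lt_top (diskPM_fin _ _ _ _) (diskPM_fin _ _ _ _))).ne

lemma ann_meas1 (b b' : ℝ) (v : E2) : Measurable (fun u => ann b b' u v) := by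
  unfold ann
  refine Measurable.ite ?_ measurable_const measurable_const
  exact measurableSet_Ioc.preimage (by fun_prop)

lemma main_bound (rf : ℝ) (hrf : 0 < rf) (B : Set E2) (hBfin : volume B ≠ ⊤)
    (bm bp bm' bp' dm dp q lam K mn : ℝ)
    (h1 : 0 ≤ bm) (h2 : bm ≤ bp) (h3 : bp ≤ rf) (h1' : 0 ≤ bm') (h2' : bm' ≤ bp')
    (h3' : bp' ≤ rf) (hdm : 0 ≤ dm) (hlt : dm < dp) (hl : 0 < lam)
    (hK0 : 0 ≤ K) (hmn : mn = 8 * π * rf * min (bp - bm) (bp' - bm')) (hmn0 : 0 ≤ mn)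
    (hDv : ∀ x y : E2, volume.real (Dset x y dm dp) ≤ lam + K * Wf dp (dp - dm) ‖x - y‖) :
    (∫ x₃ in B, ∫ x₂ in B,
          ∫ x₁ in B, ∫ y₁ in B,
            ann bm bp x₁ x₂ * ann bm' bp' x₁ x₃ * ann 0 q x₂ x₃ *
              (if y₁ ∈ Dset x₂ x₃ dm dp then (1 : ℝ) else 0))
      ≤ (lam * (8 * π * rf * (bp - bm) * (8 * π * rf * (bp' - bm'))) +
          mn * K * (4 * π / (dp - dm))) * volume.real B := by
  have hpi := Real.pi_pos
  have hdel : 0 < dp - dm := by linarith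
  have : IsFiniteMeasure (volume.restrict B) := ⟨by simpa using hBfin.lt_top⟩
  have hmeas1 := ann_meas1
  have hint1 : ∀ b b' : ℝ, ∀ v : E2, Integrable (fun u => ann b b' u v) (volume.restrict B) := by
    intro b b' v
    refine Integrable.of_bound (hmeas1 b b' v).aestronglyMeasurable 1 (ae_of_all _ fun u => ?_)
    rw [Real.norm_of_nonneg (ann_nonneg _ _ _ _)]; exact ann_le_one _ _ _ _
  -- the product, for fixed x₃, as a function of (x₂, x₁)
  have hprod : ∀ x₃ : E2, Integrable
      (Function.uncurry fun x₂ x₁ => ann bm bp x₁ x₂ * ann bm' bp' x₁ x₃)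
      ((volume.restrict B).prod (volume.restrict B)) := by
    intro x₃
    refine Integrable.of_bound (C := 1) ?_ (ae_of_all _ fun p => ?_)
    · apply Measurable.aestronglyMeasurable
      exact ((ann_meas bm bp).comp measurable_swap).mul
        ((hmeas1 bm' bp' x₃).comp measurable_snd)
    · simp only [Function.uncurry]
      rw [Real.norm_of_nonneg (mul_nonneg (ann_nonneg _ _ _ _) (ann_nonneg _ _ _ _))]
      exact mul_le_one₀ (ann_le_one _ _ _ _) (ann_nonneg _ _ _ _) (ann_le_one _ _ _ _)
  have hint2 : ∀ x₂ x₃ : E2, Integrable (fun x₁ => ann bm bp x₁ x₂ * ann bm' bp' x₁ x₃)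
      (volume.restrict B) := by
    intro x₂ x₃
    refine Integrable.of_bound (C := 1)
      ((hmeas1 _ _ _).mul (hmeas1 _ _ _)).aestronglyMeasurable (ae_of_all _ fun p => ?_)
    rw [Real.norm_of_nonneg (mul_nonneg (ann_nonneg _ _ _ _) (ann_nonneg _ _ _ _))]
    exact mul_le_one₀ (ann_le_one _ _ _ _) (ann_nonneg _ _ _ _) (ann_le_one _ _ _ _)
  have hDnn : ∀ x₂ x₃ y : E2, (0:ℝ) ≤ (if y ∈ Dset x₂ x₃ dm dp then (1 : ℝ) else 0) := by
    intro x₂ x₃ y; split_ifs <;> norm_num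
  have hnn : ∀ x₁ x₂ x₃ y : E2, 0 ≤ ann bm bp x₁ x₂ * ann bm' bp' x₁ x₃ * ann 0 q x₂ x₃ *
              (if y ∈ Dset x₂ x₃ dm dp then (1 : ℝ) else 0) := fun x₁ x₂ x₃ y =>
    mul_nonneg (mul_nonneg (mul_nonneg (ann_nonneg _ _ _ _) (ann_nonneg _ _ _ _))
      (ann_nonneg _ _ _ _)) (hDnn _ _ _)
  -- step y
  have sy : ∀ x₁ x₂ x₃ : E2, ∫ y₁ in B, ann bm bp x₁ x₂ * ann bm' bp' x₁ x₃ * ann 0 q x₂ x₃ *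
              (if y₁ ∈ Dset x₂ x₃ dm dp then (1 : ℝ) else 0) ≤
      (ann bm bp x₁ x₂ * ann bm' bp' x₁ x₃) * (lam + K * Wf dp (dp - dm) ‖x₂ - x₃‖) := by
    intro x₁ x₂ x₃
    rw [integral_const_mul]
    have hDfin := Dset_fin x₂ x₃ dm dp
    have e1 : ∫ y₁ in B, (if y₁ ∈ Dset x₂ x₃ dm dp then (1 : ℝ) else 0) ≤
        volume.real (Dset x₂ x₃ dm dp) := by
      have e2 : (fun y₁ => (if y₁ ∈ Dset x₂ x₃ dm dp then (1 : ℝ) else 0)) =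
        (Dset x₂ x₃ dm dp).indicator (fun _ => (1:ℝ)) := by
        ext y; simp [Set.indicator]
      rw [e2, integral_indicator (Dset_meas _ _ _ _)]
      simp only [integral_const, smul_eq_mul, mul_one, measureReal_restrict_apply_univ,
        measureReal_restrict_apply (Dset_meas _ _ _ _), MeasurableSet.univ]
      exact measureReal_mono Set.inter_subset_left hDfin
    have e3 := e1.trans (hDv x₂ x₃)
    have e4 : 0 ≤ lam + K * Wf dp (dp - dm) ‖x₂ - x₃‖ := by
      have := Wf_nonneg dp (dp - dm) ‖x₂ - x₃‖
      positivity
    have a0 := mul_nonneg (ann_nonneg bm bp x₁ x₂) (ann_nonneg bm' bp' x₁ x₃)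
    calc _ ≤ ann bm bp x₁ x₂ * ann bm' bp' x₁ x₃ * ann 0 q x₂ x₃ *
          (lam + K * Wf dp (dp - dm) ‖x₂ - x₃‖) :=
          mul_le_mul_of_nonneg_left e3 (mul_nonneg a0 (ann_nonneg _ _ _ _))
      _ ≤ _ := mul_le_mul_of_nonneg_right (mul_le_of_le_one_right a0 (ann_le_one _ _ _ _)) e4
  -- step x₁
  have sx1 : ∀ x₂ x₃ : E2, ∫ x₁ in B, ∫ y₁ in B,
        ann bm bp x₁ x₂ * ann bm' bp' x₁ x₃ * ann 0 q x₂ x₃ *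
              (if y₁ ∈ Dset x₂ x₃ dm dp then (1 : ℝ) else 0) ≤
      lam * (∫ x₁ in B, ann bm bp x₁ x₂ * ann bm' bp' x₁ x₃) +
        mn * K * Wf dp (dp - dm) ‖x₂ - x₃‖ := by
    intro x₂ x₃
    have hW := Wf_nonneg dp (dp - dm) ‖x₂ - x₃‖
    have f1 : ∫ x₁ in B, ann bm bp x₁ x₂ * ann bm' bp' x₁ x₃ ≤ mn := by
      rw [hmn, mul_min_of_nonneg _ _ (by positivity)]
      apply le_min
      · refine le_trans (integral_mono (hint2 x₂ x₃) (hint1 bm bp x₂) fun x₁ => ?_)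
          (ann_integral bm bp rf x₂ B h1 h2 h3)
        exact mul_le_of_le_one_right (ann_nonneg _ _ _ _) (ann_le_one _ _ _ _)
      · refine le_trans (integral_mono (hint2 x₂ x₃) (hint1 bm' bp' x₃) fun x₁ => ?_)
          (ann_integral bm' bp' rf x₃ B h1' h2' h3')
        exact mul_le_of_le_one_left (ann_nonneg _ _ _ _) (ann_le_one _ _ _ _)
    calc _ ≤ ∫ x₁ in B, (ann bm bp x₁ x₂ * ann bm' bp' x₁ x₃) *
            (lam + K * Wf dp (dp - dm) ‖x₂ - x₃‖) := by
          apply integral_mono_of_nonneg (ae_of_all _ fun x₁ => integral_nonneg fun y => hnn _ _ _ _)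
            ((hint2 x₂ x₃).mul_const _) (ae_of_all _ fun x₁ => sy x₁ x₂ x₃)
      _ = (∫ x₁ in B, ann bm bp x₁ x₂ * ann bm' bp' x₁ x₃) *
            (lam + K * Wf dp (dp - dm) ‖x₂ - x₃‖) := integral_mul_const _ _
      _ = lam * (∫ x₁ in B, ann bm bp x₁ x₂ * ann bm' bp' x₁ x₃) +
          (∫ x₁ in B, ann bm bp x₁ x₂ * ann bm' bp' x₁ x₃) *
            (K * Wf dp (dp - dm) ‖x₂ - x₃‖) := by ring
      _ ≤ lam * (∫ x₁ in B, ann bm bp x₁ x₂ * ann bm' bp' x₁ x₃) +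
          mn * (K * Wf dp (dp - dm) ‖x₂ - x₃‖) := by gcongr
      _ = _ := by ring
  -- step x₂
  have sx2 : ∀ x₃ : E2, ∫ x₂ in B, ∫ x₁ in B, ∫ y₁ in B,
        ann bm bp x₁ x₂ * ann bm' bp' x₁ x₃ * ann 0 q x₂ x₃ *
              (if y₁ ∈ Dset x₂ x₃ dm dp then (1 : ℝ) else 0) ≤
      lam * (8 * π * rf * (bp - bm) * (8 * π * rf * (bp' - bm'))) +
        mn * K * (4 * π / (dp - dm)) := by
    intro x₃
    have hJ : Integrable (fun x₂ => ∫ x₁ in B, ann bm bp x₁ x₂ * ann bm' bp' x₁ x₃)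
        (volume.restrict B) := (hprod x₃).integral_prod_left
    have hWi : Integrable (fun x₂ => Wf dp (dp - dm) ‖x₂ - x₃‖) volume :=
      (Wf_integrable dp (dp - dm) hdel).comp_sub_right x₃
    have g1 : ∫ x₂ in B, Wf dp (dp - dm) ‖x₂ - x₃‖ ≤ 4 * π / (dp - dm) := by
      refine (setIntegral_le_integral hWi (ae_of_all _ fun _ => Wf_nonneg _ _ _)).trans ?_
      rw [integral_sub_right_eq_self (fun z : E2 => Wf dp (dp - dm) ‖z‖) x₃]
      exact Wf_integral dp (dp - dm) (by linarith) hdel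
    have g2 : ∫ x₂ in B, ∫ x₁ in B, ann bm bp x₁ x₂ * ann bm' bp' x₁ x₃ ≤
        8 * π * rf * (bp - bm) * (8 * π * rf * (bp' - bm')) := by
      rw [integral_integral_swap (hprod x₃)]
      calc _ ≤ ∫ x₁ in B, (8 * π * rf * (bp - bm)) * ann bm' bp' x₁ x₃ := by
            apply integral_mono_of_nonneg
              (ae_of_all _ fun x₁ => integral_nonneg fun y =>
                mul_nonneg (ann_nonneg _ _ _ _) (ann_nonneg _ _ _ _))
              ((hint1 bm' bp' x₃).const_mul _) (ae_of_all _ fun x₁ => ?_)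
            simp only
            rw [integral_mul_const]
            apply mul_le_mul_of_nonneg_right _ (ann_nonneg _ _ _ _)
            simp_rw [ann_symm bm bp x₁]
            exact ann_integral bm bp rf x₁ B h1 h2 h3
        _ = (8 * π * rf * (bp - bm)) * ∫ x₁ in B, ann bm' bp' x₁ x₃ := integral_const_mul _ _
        _ ≤ _ := by
          have : 0 ≤ bp - bm := by linarith
          exact mul_le_mul_of_nonneg_left (ann_integral bm' bp' rf x₃ B h1' h2' h3')
            (by positivity)
    calc _ ≤ ∫ x₂ in B, (lam * (∫ x₁ in B, ann bm bp x₁ x₂ * ann bm' bp' x₁ x₃) +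
        mn * K * Wf dp (dp - dm) ‖x₂ - x₃‖) := by
          apply integral_mono_of_nonneg (ae_of_all _ fun x₂ => integral_nonneg fun x₁ =>
            integral_nonneg fun y => hnn _ _ _ _)
            ((hJ.const_mul _).add (hWi.restrict.const_mul _)) (ae_of_all _ fun x₂ => sx1 x₂ x₃)
      _ = lam * (∫ x₂ in B, ∫ x₁ in B, ann bm bp x₁ x₂ * ann bm' bp' x₁ x₃) +
          mn * K * ∫ x₂ in B, Wf dp (dp - dm) ‖x₂ - x₃‖ := by
          rw [integral_add (hJ.const_mul _) (hWi.restrict.const_mul _), integral_const_mul,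
            integral_const_mul]
      _ ≤ _ := by gcongr
  calc _ ≤ ∫ x₃ in B, (lam * (8 * π * rf * (bp - bm) * (8 * π * rf * (bp' - bm'))) +
        mn * K * (4 * π / (dp - dm))) := by
        apply integral_mono_of_nonneg (ae_of_all _ fun x₃ => integral_nonneg fun x₂ =>
            integral_nonneg fun x₁ => integral_nonneg fun y => hnn _ _ _ _)
            (integrable_const _) (ae_of_all _ fun x₃ => sx2 x₃)
    _ = _ := by
      rw [integral_const, measureReal_restrict_apply_univ, smul_eq_mul, mul_comm]

/-- **Lemma 7.7 (special configurations).** For every `r_f > 0` and `M > 0` there is a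
constant `C > 0` such that for every closed disk `B_M` of radius `M` and all
`b₋, b₊, b₋', b₊', d₋, d₊ ∈ [0, r_f]` with `d₋ < d₊` and either `b₋ < b₊ = b₋' < b₊'`
or `b₋ = b₋' < b₊ = b₊'`,
`∫_{B_M⁴} 1{b₋ < |x₁−x₂|/2 ≤ b₊} 1{b₋' < |x₁−x₃|/2 ≤ b₊'} 1{0 < |x₂−x₃|/2 ≤ b₊∨b₊'}
  1{y₁ ∈ D_{d₋,d₊}(x₂,x₃)} dy₁ dx₁ dx₂ dx₃
  ≤ C·|B_M|·(δ_b ∧ δ_{b'})·(δ_b ∨ δ_{b'})^{3/4}·δ_d^{3/4}`. -/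
theorem quadruple_integral_special_config_bound (rf M : ℝ) (hrf : 0 < rf) (hM : 0 < M) :
    ∃ C > 0, ∀ (c : E2) (bm bp bm' bp' dm dp : ℝ),
      bm ∈ Set.Icc 0 rf → bp ∈ Set.Icc 0 rf → bm' ∈ Set.Icc 0 rf → bp' ∈ Set.Icc 0 rf →
      dm ∈ Set.Icc 0 rf → dp ∈ Set.Icc 0 rf → dm < dp →
      ((bm < bp ∧ bp = bm' ∧ bm' < bp') ∨ (bm = bm' ∧ bm < bp ∧ bp = bp')) →
      (∫ x₃ in Metric.closedBall c M, ∫ x₂ in Metric.closedBall c M,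
          ∫ x₁ in Metric.closedBall c M, ∫ y₁ in Metric.closedBall c M,
            (if ‖x₁ - x₂‖ / 2 ∈ Set.Ioc bm bp then (1 : ℝ) else 0) *
              (if ‖x₁ - x₃‖ / 2 ∈ Set.Ioc bm' bp' then (1 : ℝ) else 0) *
              (if ‖x₂ - x₃‖ / 2 ∈ Set.Ioc 0 (max bp bp') then (1 : ℝ) else 0) *
              (if y₁ ∈ Dset x₂ x₃ dm dp then (1 : ℝ) else 0))
        ≤ C * (volume (Metric.closedBall c M)).toReal *
            min (bp - bm) (bp' - bm') * (max (bp - bm) (bp' - bm')) ^ ((3 : ℝ) / 4) *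
            (dp - dm) ^ ((3 : ℝ) / 4) := by
  have hpi := Real.pi_pos
  refine ⟨(8 * π * rf) ^ 2 +
    8 * π * rf * ((16 * π * rf) ^ 4 * (4 * rf ^ 2 + 2 * rf) ^ 2) * (4 * π), by positivity, ?_⟩
  intro c bm bp bm' bp' dm dp h1 h2 h3 h4 h5 h6 hlt hcase
  have hb : bm < bp := by rcases hcase with h | h <;> linarith [h.1, h.2.1, h.2.2]
  have hb' : bm' < bp' := by rcases hcase with h | h <;> linarith [h.1, h.2.1, h.2.2]
  have hmax : 0 < max (bp - bm) (bp' - bm') := lt_max_of_lt_left (by linarith)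
  have hdel : 0 < dp - dm := by linarith
  obtain ⟨lam, hl, e1, e2⟩ := rpow_aux _ (dp - dm) hmax hdel
  have hmm : min (bp - bm) (bp' - bm') * max (bp - bm) (bp' - bm') = (bp - bm) * (bp' - bm') :=
    min_mul_max _ _
  have hmain := main_bound rf hrf (Metric.closedBall c M) measure_closedBall_lt_top.ne
    bm bp bm' bp' dm dp (max bp bp') lam
    ((16 * π * rf) ^ 4 * (4 * rf ^ 2 + 2 * rf) ^ 2 * (dp - dm) ^ 4 / lam ^ 3) _ h1.1 hb.le h2.2 h3.1
    hb'.le h4.2 h5.1 hlt hl (by positivity) rfl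
    (mul_nonneg (by positivity) (le_min (by linarith) (by linarith)))
    (fun x y => Dset_vol x y dm dp rf lam h5.1 hlt h6.2 hl)
  refine le_trans hmain (le_of_eq ?_)
  set mn := min (bp - bm) (bp' - bm')
  set mx := max (bp - bm) (bp' - bm')
  change _ = _ * volume.real (Metric.closedBall c M) * _ * _ * _
  set V := volume.real (Metric.closedBall c M)
  have e3 : (dp - dm) ^ 4 / lam ^ 3 * (1 / (dp - dm)) = mx ^ ((3:ℝ)/4) * (dp - dm) ^ ((3:ℝ)/4) := by
    rw [← e2]; field_simp
  calc _ = ((8 * π * rf) ^ 2 * (lam * ((bp - bm) * (bp' - bm'))) +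
    8 * π * rf * mn * ((16 * π * rf) ^ 4 * (4 * rf ^ 2 + 2 * rf) ^ 2) * (4 * π) *
      ((dp - dm) ^ 4 / lam ^ 3 * (1 / (dp - dm)))) * V := by ring
    _ = ((8 * π * rf) ^ 2 * (mn * (lam * mx)) +
    8 * π * rf * mn * ((16 * π * rf) ^ 4 * (4 * rf ^ 2 + 2 * rf) ^ 2) * (4 * π) *
      ((dp - dm) ^ 4 / lam ^ 3 * (1 / (dp - dm)))) * V := by rw [← hmm]; ring
    _ = _ := by rw [e3, e1]; ring
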